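/- Let L = (V,E) be one of the square, triangular, or hexagonal lattices embedded in the plane, invariant under translations by (a,0) and (0,b) for some least positive a and b. A translation-invariant, positively associated probability measure P on {0,1}^E has the box-crossing property if and only if both of the following hold: (a) for every α > 0 there exists δ > 0 such that P[C_h(αN, N)] > δ for all sufficiently large N ∈ ℕ; (b) there exist β, δ > 0 such that P[C_v(N, βN)] > δ for all sufficiently large N ∈ ℕ. -/

import Mathlib

open MeasureTheory Set

set_option linter.unusedVariables false

namespace Perc

/-- Points of the plane. -/
abbrev Pt := ℝ × ℝ

/-- A lattice embedded in the plane, with edges indexed by `E`;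
each edge is embedded as the segment between the two endpoints given by `ends`. -/
structure LatticeOn (E : Type) where
  ends : E → Pt × Pt

/-- Bond configurations. -/
abbrev Config (E : Type) := E → Bool

/-- `P` is the Bernoulli bond-percolation product measure in which edge `e`
is open with probability `p e`, independently over edges. -/
def IsBernoulliProduct {E : Type} (p : E → ℝ) (P : Measure (Config E)) : Prop :=
  IsProbabilityMeasure P ∧
    ∀ (s : Finset E) (f : E → Bool),
      P {ω | ∀ e ∈ s, ω e = f e} =
        ∏ e ∈ s, ENNReal.ofReal (if f e then p e else 1 - p e)

/-- The union of the closed segments of the open edges. -/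
def openEdgeSet {E : Type} (L : LatticeOn E) (ω : Config E) : Set Pt :=
  ⋃ e ∈ {e : E | ω e = true}, segment ℝ (L.ends e).1 (L.ends e).2

/-- There is an arc, contained in `S` and in the union of the open edges,
with one endpoint in `A` and the other in `B`. -/
def CrossingIn {E : Type} (L : LatticeOn E) (ω : Config E) (S A B : Set Pt) : Prop :=
  ∃ γ : ℝ → Pt, ContinuousOn γ (Icc 0 1) ∧ γ 0 ∈ A ∧ γ 1 ∈ B ∧
    ∀ t ∈ Icc (0:ℝ) 1, γ t ∈ S ∩ openEdgeSet L ω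

/-- Rotation of the plane by angle `θ`. -/
noncomputable def rot (θ : ℝ) (z : Pt) : Pt :=
  (Real.cos θ * z.1 - Real.sin θ * z.2, Real.sin θ * z.1 + Real.cos θ * z.2)

/-- `f` comprises a rotation and a translation. -/
def IsRotTrans (f : Pt → Pt) : Prop := ∃ θ : ℝ, ∃ t : Pt, f = fun z => rot θ z + t

def stdRect (h l : ℝ) : Set Pt := {z | 0 ≤ z.1 ∧ z.1 ≤ h ∧ 0 ≤ z.2 ∧ z.2 ≤ l}
def leftSide (h l : ℝ) : Set Pt := {z | z.1 = 0 ∧ 0 ≤ z.2 ∧ z.2 ≤ l}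
def rightSide (h l : ℝ) : Set Pt := {z | z.1 = h ∧ 0 ≤ z.2 ∧ z.2 ≤ l}
def bottomSide (h l : ℝ) : Set Pt := {z | z.2 = 0 ∧ 0 ≤ z.1 ∧ z.1 ≤ h}
def topSide (h l : ℝ) : Set Pt := {z | z.2 = l ∧ 0 ≤ z.1 ∧ z.1 ≤ h}

/-- The box `f(stdRect h l)` (where `f` is a rotation plus translation) possesses
open crossings in both directions. -/
def HasBoxCrossings {E : Type} (L : LatticeOn E) (ω : Config E) (h l : ℝ) (f : Pt → Pt) : Prop :=
  CrossingIn L ω (f '' stdRect h l) (f '' leftSide h l) (f '' rightSide h l) ∧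
  CrossingIn L ω (f '' stdRect h l) (f '' bottomSide h l) (f '' topSide h l)

/-- The box-crossing property: for every `α > 0` there is `δ > 0` such that every box
of size `αN × N` (any position and orientation) possesses open crossings with
probability at least `δ`, for all large `N`. -/
def BoxCrossingProperty {E : Type} (L : LatticeOn E) (P : Measure (Config E)) : Prop :=
  ∀ α : ℝ, 0 < α → ∃ δ : ℝ, 0 < δ ∧ ∃ N₀ : ℕ, ∀ N : ℕ, N₀ ≤ N →
    ∀ f : Pt → Pt, IsRotTrans f →
      ENNReal.ofReal δ ≤ P {ω | HasBoxCrossings L ω (α * N) N f}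

/-- Horizontal-crossing event of the box `[-m,m] × [0,n]`. -/
def Ch {E : Type} (L : LatticeOn E) (m n : ℝ) (ω : Config E) : Prop :=
  CrossingIn L ω {z | -m ≤ z.1 ∧ z.1 ≤ m ∧ 0 ≤ z.2 ∧ z.2 ≤ n}
    {z | z.1 = -m ∧ 0 ≤ z.2 ∧ z.2 ≤ n} {z | z.1 = m ∧ 0 ≤ z.2 ∧ z.2 ≤ n}

/-- Vertical-crossing event of the box `[-m,m] × [0,n]`. -/
def Cv {E : Type} (L : LatticeOn E) (m n : ℝ) (ω : Config E) : Prop :=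
  CrossingIn L ω {z | -m ≤ z.1 ∧ z.1 ≤ m ∧ 0 ≤ z.2 ∧ z.2 ≤ n}
    {z | z.2 = 0 ∧ -m ≤ z.1 ∧ z.1 ≤ m} {z | z.2 = n ∧ -m ≤ z.1 ∧ z.1 ≤ m}

/-- `u` and `v` are the endpoints of some open edge. -/
def openAdj {E : Type} (L : LatticeOn E) (ω : Config E) (u v : Pt) : Prop :=
  ∃ e, ω e = true ∧ (L.ends e = (u, v) ∨ L.ends e = (v, u))

/-- `u` and `v` are joined by a path of open edges. -/
def openConn {E : Type} (L : LatticeOn E) (ω : Config E) : Pt → Pt → Prop :=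
  Relation.ReflTransGen (openAdj L ω)

/-- The open cluster at `v`. -/
def cluster {E : Type} (L : LatticeOn E) (ω : Config E) (v : Pt) : Set Pt :=
  {u | openConn L ω v u}

/-- The vertex set of the lattice. -/
def vertexSet {E : Type} (L : LatticeOn E) : Set Pt :=
  ⋃ e : E, {(L.ends e).1, (L.ends e).2}

/-- `v` is the endpoint of an infinite open self-avoiding path. -/
def ConnToInfinity {E : Type} (L : LatticeOn E) (ω : Config E) (v : Pt) : Prop :=
  ∃ γ : ℕ → Pt, γ 0 = v ∧ Function.Injective γ ∧ ∀ n, openAdj L ω (γ n) (γ (n + 1))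

/-- Euclidean distance on the plane. -/
noncomputable def edist2 (u v : Pt) : ℝ := Real.sqrt ((u.1 - v.1) ^ 2 + (u.2 - v.2) ^ 2)

/-- `rad (C_v) ≥ r`, where `rad (C_v)` is the supremum of all `x` such that `C_v`
meets the complement of the open Euclidean ball `v + S_x`. -/
def RadiusGE {E : Type} (L : LatticeOn E) (ω : Config E) (v : Pt) (r : ℝ) : Prop :=
  ∀ x : ℝ, x < r → ∃ u ∈ cluster L ω v, x ≤ edist2 v u

/-- `κ_□`. -/
def kappaS (a b : ℝ) : ℝ := a + b - 1
/-- `κ_△`. -/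
def kappaT (a b c : ℝ) : ℝ := a + b + c - a * b * c - 1
/-- `κ_⬡`. -/
def kappaH (a b c : ℝ) : ℝ := -kappaT (1 - a) (1 - b) (1 - c)

/-- Edges of a square-type lattice: `(a, b, true)` is the `horizontal`-class edge
at `(a,b)` and `(a, b, false)` the `vertical`-class edge at `(a,b)`. -/
abbrev SqE := ℤ × ℤ × Bool
/-- Edges of the triangular lattice (also indexing the dual hexagonal edges):
`(a, b, i)` with `i = 0` horizontal, `i = 1` the right edge of an upwards pointing
triangle, `i = 2` the left edge of an upwards pointing triangle, in row `b`. -/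
abbrev TriE := ℤ × ℤ × Fin 3

/-- The unit square lattice, with vertex set `ℤ²`. -/
noncomputable def sqLattice : LatticeOn SqE :=
  ⟨fun e =>
    if e.2.2 then (((e.1 : ℝ), (e.2.1 : ℝ)), ((e.1 : ℝ) + 1, (e.2.1 : ℝ)))
    else (((e.1 : ℝ), (e.2.1 : ℝ)), ((e.1 : ℝ), (e.2.1 : ℝ) + 1))⟩

/-- The dual of the unit square lattice (shifted by `(1/2, 1/2)`), with each dual edge
indexed by the primal edge it crosses. -/
noncomputable def sqDualLattice : LatticeOn SqE :=
  ⟨fun e =>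
    if e.2.2 then
      (((e.1 : ℝ) + 1 / 2, (e.2.1 : ℝ) - 1 / 2), ((e.1 : ℝ) + 1 / 2, (e.2.1 : ℝ) + 1 / 2))
    else
      (((e.1 : ℝ) - 1 / 2, (e.2.1 : ℝ) + 1 / 2), ((e.1 : ℝ) + 1 / 2, (e.2.1 : ℝ) + 1 / 2))⟩

/-- Vertices of the triangular lattice (equilateral triangles of side `√3`,
one family of edges horizontal). -/
noncomputable def tv (a b : ℤ) : Pt :=
  (Real.sqrt 3 * ((a : ℝ) + (b : ℝ) / 2), 3 / 2 * (b : ℝ))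

/-- The triangular lattice. -/
noncomputable def triLattice : LatticeOn TriE :=
  ⟨fun e =>
    if e.2.2 = 0 then (tv e.1 e.2.1, tv (e.1 + 1) e.2.1)
    else if e.2.2 = 1 then (tv (e.1 + 1) e.2.1, tv e.1 (e.2.1 + 1))
    else (tv e.1 e.2.1, tv e.1 (e.2.1 + 1))⟩

/-- Circumcentre of the upwards pointing triangle with base vertex `tv a b`. -/
noncomputable def hup (a b : ℤ) : Pt :=
  (Real.sqrt 3 * ((a : ℝ) + ((b : ℝ) + 1) / 2), 3 / 2 * (b : ℝ) + 1 / 2)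

/-- Circumcentre of the downwards pointing triangle below the edge `tv a b – tv (a+1) b`. -/
noncomputable def hdown (a b : ℤ) : Pt :=
  (Real.sqrt 3 * ((a : ℝ) + ((b : ℝ) + 1) / 2), 3 / 2 * (b : ℝ) - 1 / 2)

/-- The hexagonal lattice, the planar dual of `triLattice`, with vertices at the
circumcentres of the triangles; each hexagonal edge is indexed by the triangular
edge it crosses. -/
noncomputable def hexLattice : LatticeOn TriE :=
  ⟨fun e =>
    if e.2.2 = 0 then (hdown e.1 e.2.1, hup e.1 e.2.1)
    else if e.2.2 = 1 then (hup e.1 e.2.1, hdown e.1 (e.2.1 + 1))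
    else (hup e.1 e.2.1, hdown (e.1 - 1) (e.2.1 + 1))⟩

/-- The square lattice with horizontal edges of length `√3` and vertical edges of
length `1` (as in the mixed lattices). -/
noncomputable def sqStretch : LatticeOn SqE :=
  ⟨fun e =>
    if e.2.2 then
      ((Real.sqrt 3 * (e.1 : ℝ), (e.2.1 : ℝ)), (Real.sqrt 3 * ((e.1 : ℝ) + 1), (e.2.1 : ℝ)))
    else ((Real.sqrt 3 * (e.1 : ℝ), (e.2.1 : ℝ)), (Real.sqrt 3 * (e.1 : ℝ), (e.2.1 : ℝ) + 1))⟩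

/-- Vertices of the square lattice rotated by `π/4`. -/
noncomputable def rv (a b : ℤ) : Pt :=
  (((a : ℝ) - (b : ℝ)) / Real.sqrt 2, ((a : ℝ) + (b : ℝ)) / Real.sqrt 2)

/-- The square lattice rotated by `π/4`: edges `(a,b,true)` are inclined at angle `π/4`
and edges `(a,b,false)` at angle `3π/4`; the row (height) of such an edge is `a + b`. -/
noncomputable def rsqLattice : LatticeOn SqE :=
  ⟨fun e =>
    if e.2.2 then (rv e.1 e.2.1, rv (e.1 + 1) e.2.1)
    else (rv e.1 e.2.1, rv e.1 (e.2.1 + 1))⟩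

/-- Inhomogeneous intensities on the square lattice: `ph` on horizontal edges,
`pv` on vertical ones. -/
def sqInt (ph pv : ℝ) : SqE → ℝ := fun e => if e.2.2 then ph else pv

/-- Inhomogeneous intensities on the triangular (or hexagonal) lattice:
`p0` on class-0 edges, `p1` on class-1, `p2` on class-2. -/
def triInt (p0 p1 p2 : ℝ) : TriE → ℝ := fun e => ![p0, p1, p2] e.2.2

/-- Highly inhomogeneous intensities on the triangular (or hexagonal) lattice:
`p` on horizontal-class edges, `q n` on right edges of upwards pointing triangles at
height `n`, `q' n` on left edges of upwards pointing triangles at height `n`. -/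
def triHI (p : ℝ) (q q' : ℤ → ℝ) : TriE → ℝ := fun e =>
  if e.2.2 = 0 then p else if e.2.2 = 1 then q e.2.1 else q' e.2.1

/-- Highly inhomogeneous intensities on the rotated square lattice: `q n` on edges
inclined at `π/4` at height `n`, `q' n` on edges inclined at `3π/4` at height `n`. -/
def rsqHI (q q' : ℤ → ℝ) : SqE → ℝ := fun e =>
  if e.2.2 then q (e.1 + e.2.1) else q' (e.1 + e.2.1)


/-- `P` is invariant under the configuration shift induced by the edge map `σ`. -/
def TranslationInvariantUnder {E : Type} (P : Measure (Config E)) (σ : E → E) : Prop :=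
  Measure.map (fun ω : Config E => ω ∘ σ) P = P

/-- An increasing event of configurations. -/
def IncreasingEvent {E : Type} (A : Set (Config E)) : Prop :=
  ∀ ω ω' : Config E, (∀ e, ω e = true → ω' e = true) → ω ∈ A → ω' ∈ A

/-- Positive association: `P(A ∩ B) ≥ P(A) P(B)` for increasing events `A`, `B`. -/
def PositivelyAssociated {E : Type} (P : Measure (Config E)) : Prop :=
  ∀ A B : Set (Config E), MeasurableSet A → MeasurableSet B →
    IncreasingEvent A → IncreasingEvent B → P A * P B ≤ P (A ∩ B)

/-- The equivalence of Proposition `RSW`: `P` has the box-crossing property iff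
(a) boxes `[-αN, αN] × [0, N]` are crossed horizontally with probability bounded away
from `0`, and (b) for some aspect ratio `β > 0`, boxes `[-N, N] × [0, βN]` are crossed
vertically with probability bounded away from `0`. -/
def BoxCrossingEquiv {E : Type} (L : LatticeOn E) (P : Measure (Config E)) : Prop :=
  BoxCrossingProperty L P ↔
    ((∀ α : ℝ, 0 < α → ∃ δ : ℝ, 0 < δ ∧ ∃ N₀ : ℕ, ∀ N : ℕ, N₀ ≤ N →
        ENNReal.ofReal δ < P {ω | Ch L (α * N) N ω}) ∧
     (∃ β δ : ℝ, 0 < β ∧ 0 < δ ∧ ∃ N₀ : ℕ, ∀ N : ℕ, N₀ ≤ N →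
        ENNReal.ofReal δ < P {ω | Cv L (N : ℝ) (β * N) ω}))

/-! ### Two crossing paths in a rectangle meet -/

/-- A continuous function starting in `[c, c + π]` along which `sin (· - c)` is nonnegative
cannot leave `[c, c + π]`. -/
lemma mem_Icc_of_sin_nonneg {h : ℝ → ℝ} (hc : Continuous h) {c : ℝ}
    (h0 : h 0 ∈ Icc c (c + Real.pi))
    (hs : ∀ t ∈ Icc (0 : ℝ) 1, 0 ≤ Real.sin (h t - c)) : h 1 ∈ Icc c (c + Real.pi) := by
  have hpi := Real.pi_pos
  constructor
  · by_contra! hlt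
    obtain ⟨v, hv1, hv2⟩ := exists_between (max_lt hlt (by linarith : c - Real.pi < c))
    rw [max_lt_iff] at hv1
    obtain ⟨t, ht, rfl⟩ := intermediate_value_Icc' zero_le_one hc.continuousOn
      (show v ∈ Icc (h 1) (h 0) from ⟨hv1.1.le, hv2.le.trans h0.1⟩)
    have := Real.sin_neg_of_neg_of_neg_pi_lt (x := h t - c) (by linarith) (by linarith)
    linarith [hs t ht]
  · by_contra! hlt
    obtain ⟨v, hv1, hv2⟩ :=
      exists_between (lt_min hlt (by linarith : c + Real.pi < c + 2 * Real.pi))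
    rw [lt_min_iff] at hv2
    obtain ⟨t, ht, rfl⟩ := intermediate_value_Icc zero_le_one hc.continuousOn
      (show v ∈ Icc (h 0) (h 1) from ⟨h0.2.trans hv1.le, hv2.1.le⟩)
    have := Real.sin_neg_of_neg_of_neg_pi_lt (x := h t - c - 2 * Real.pi)
      (by linarith) (by linarith)
    rw [Real.sin_sub_two_pi] at this
    linarith [hs t ht]

/-- A path from the left to the right of a rectangle meets every path from its bottom
to its top. -/
lemma exists_eq_of_crossing {f g : unitInterval → Pt} (hf : Continuous f) (hg : Continuous g)
    (hl : ∀ t, (f 0).1 ≤ (g t).1) (hr : ∀ t, (g t).1 ≤ (f 1).1)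
    (hb : ∀ s, (g 0).2 ≤ (f s).2) (ht : ∀ s, (f s).2 ≤ (g 1).2) :
    ∃ s t, f s = g t := by
  by_contra! hne
  have hpi := Real.pi_pos
  let pr : ℝ → unitInterval := projIcc 0 1 zero_le_one
  have hpr : Continuous pr := continuous_projIcc
  have pr0 : pr 0 = 0 := projIcc_left _
  have pr1 : pr 1 = 1 := projIcc_right _
  let F : C(ℝ × ℝ, ℂ) :=
    ⟨fun q => ⟨(f (pr q.1)).1 - (g (pr q.2)).1, (f (pr q.1)).2 - (g (pr q.2)).2⟩, by
      have : Continuous fun q : ℝ × ℝ =>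
          Complex.equivRealProdCLM.symm (f (pr q.1) - g (pr q.2)) := by fun_prop
      exact this⟩
  have Fre : ∀ q, (F q).re = (f (pr q.1)).1 - (g (pr q.2)).1 := fun _ => rfl
  have Fim : ∀ q, (F q).im = (f (pr q.1)).2 - (g (pr q.2)).2 := fun _ => rfl
  have hF0 : ∀ q, F q ∈ ({0}ᶜ : Set ℂ) := by
    intro q hq
    have hq : F q = 0 := hq
    refine hne (pr q.1) (pr q.2) (Prod.ext ?_ ?_)
    · simpa [Fre, sub_eq_zero] using congrArg Complex.re hq
    · simpa [Fim, sub_eq_zero] using congrArg Complex.im hq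
  obtain ⟨G, ⟨hG0, hG⟩, -⟩ :=
    Complex.isCoveringMapOn_exp.existsUnique_continuousMap_lifts F (a₀ := (0, 0))
      (e₀ := Complex.log (F (0, 0))) (Complex.exp_log (hF0 _)) hF0
  have hG : ∀ q, Complex.exp (G q) = F q := fun q => congrFun hG q
  have hcos : ∀ q, (F q).re = Real.exp (G q).re * Real.cos (G q).im := fun q => by
    rw [← hG, Complex.exp_re]
  have hsin : ∀ q, (F q).im = Real.exp (G q).re * Real.sin (G q).im := fun q => by
    rw [← hG, Complex.exp_im]
  have bot : ∀ s, 0 ≤ Real.sin (G (s, 0)).im := fun s => by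
    have : 0 ≤ (F (s, 0)).im := by simpa [Fre, Fim, pr0] using hb (pr s)
    exact nonneg_of_mul_nonneg_right (hsin _ ▸ this) (Real.exp_pos _)
  have top : ∀ s, Real.sin (G (s, 1)).im ≤ 0 := fun s => by
    have : (F (s, 1)).im ≤ 0 := by simpa [Fre, Fim, pr1] using ht (pr s)
    exact nonpos_of_mul_nonpos_right (hsin _ ▸ this) (Real.exp_pos _)
  have left : ∀ t, Real.cos (G (0, t)).im ≤ 0 := fun t => by
    have : (F (0, t)).re ≤ 0 := by simpa [Fre, Fim, pr0] using hl (pr t)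
    exact nonpos_of_mul_nonpos_right (hcos _ ▸ this) (Real.exp_pos _)
  have right : ∀ t, 0 ≤ Real.cos (G (1, t)).im := fun t => by
    have : 0 ≤ (F (1, t)).re := by simpa [Fre, Fim, pr1] using hr (pr t)
    exact nonneg_of_mul_nonneg_right (hcos _ ▸ this) (Real.exp_pos _)
  have c00 : (G (0, 0)).im ∈ Icc (Real.pi / 2) Real.pi := by
    have h1 : (G (0, 0)).im ≤ Real.pi := by
      rw [hG0, Complex.log_im]; exact Complex.arg_le_pi _
    have h2 : -Real.pi < (G (0, 0)).im := by
      rw [hG0, Complex.log_im]; exact Complex.neg_pi_lt_arg _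
    have h3 : 0 ≤ (G (0, 0)).im := by
      rw [hG0, Complex.log_im, Complex.arg_nonneg_iff]
      simpa [Fre, Fim, pr0] using hb 0
    refine ⟨?_, h1⟩
    by_contra! h
    linarith [left 0, Real.cos_pos_of_mem_Ioo ⟨by linarith, h⟩]
  have c10 := mem_Icc_of_sin_nonneg (h := fun s => (G (s, 0)).im) (by fun_prop) (c := 0)
    ⟨by linarith [c00.1], by linarith [c00.2]⟩ (fun t _ => by simpa using bot t)
  have c10' : (G (1, 0)).im ≤ Real.pi / 2 := by
    by_contra! h
    linarith [right 0, Real.cos_neg_of_pi_div_two_lt_of_lt h (by linarith [c10.2])]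
  have c11 := mem_Icc_of_sin_nonneg (h := fun t => (G (1, t)).im) (by fun_prop)
    (c := -(Real.pi / 2)) ⟨by linarith [c10.1], by linarith⟩
    (fun t _ => by simpa [sub_neg_eq_add, Real.sin_add_pi_div_two] using right t)
  have c11' : (G (1, 1)).im ≤ 0 := by
    by_contra! h
    linarith [top 1, Real.sin_pos_of_pos_of_lt_pi h (by linarith [c11.2])]
  have c01 := mem_Icc_of_sin_nonneg (h := fun s => (G (1 - s, 1)).im) (by fun_prop)
    (c := -Real.pi) ⟨by simpa using (by linarith [c11.1] : -Real.pi ≤ (G (1, 1)).im),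
      by simpa using c11'⟩
    (fun t _ => by simpa [sub_neg_eq_add, Real.sin_add_pi] using top (1 - t))
  have c01' := mem_Icc_of_sin_nonneg (h := fun t => (G (0, t)).im) (by fun_prop)
    (c := Real.pi / 2) ⟨c00.1, by linarith [c00.2]⟩
    (fun t _ => by simpa [Real.sin_sub_pi_div_two] using left t)
  have e1 := c01.2
  have e2 := c01'.1
  simp only [sub_self] at e1
  linarith

/-! ### Operations on joining paths -/

lemma joinedIn_of_path {F : Set Pt} {x y : Pt} (γ : Path x y) (h : ∀ t, γ t ∈ F)
    (s t : unitInterval) : JoinedIn F (γ s) (γ t) :=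
  ⟨γ.subpath s t, fun _ => h _⟩

/-- Two crossing paths can be concatenated at a common point. -/
lemma _root_.JoinedIn.of_crossing {F₁ F₂ F : Set Pt} {A B C D : Pt} (h₁ : JoinedIn F₁ A B)
    (h₂ : JoinedIn F₂ C D) (hF₁ : F₁ ⊆ F) (hF₂ : F₂ ⊆ F)
    (hv : ∀ z ∈ F₁, C.2 ≤ z.2 ∧ z.2 ≤ D.2) (hh : ∀ z ∈ F₂, A.1 ≤ z.1 ∧ z.1 ≤ B.1) :
    JoinedIn F A C := by
  obtain ⟨f, hf⟩ := h₁
  obtain ⟨g, hg⟩ := h₂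
  obtain ⟨s, t, hst⟩ := exists_eq_of_crossing f.continuous g.continuous
    (fun t => by simpa using (hh _ (hg t)).1) (fun t => by simpa using (hh _ (hg t)).2)
    (fun s => by simpa using (hv _ (hf s)).1) (fun s => by simpa using (hv _ (hf s)).2)
  have e₁ := (joinedIn_of_path f hf 0 s).mono hF₁
  have e₂ := (joinedIn_of_path g hg t 0).mono hF₂
  rw [← hst] at e₂
  simpa using e₁.trans e₂

/-- A path along which `φ` passes from below `a` to above `b` contains a path on which `φ`
runs from `a` to `b` while taking values in `[a, b]`. -/
lemma _root_.JoinedIn.exists_between {F : Set Pt} {x y : Pt} (h : JoinedIn F x y) {φ : Pt → ℝ}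
    (hφ : Continuous φ) {a b : ℝ} (hab : a ≤ b) (hx : φ x ≤ a) (hy : b ≤ φ y) :
    ∃ x' y', φ x' = a ∧ φ y' = b ∧ JoinedIn (F ∩ {z | a ≤ φ z ∧ φ z ≤ b}) x' y' := by
  obtain ⟨γ, hγ⟩ := h
  let k : ℝ → ℝ := fun t => φ (γ.extend t)
  have hk : Continuous k := hφ.comp γ.continuous_extend
  have k0 : k 0 = φ x := by simp [k]
  have k1 : k 1 = φ y := by simp [k]
  obtain ⟨t₁, ⟨ht₁, hkt₁⟩, hmin⟩ := (isCompact_Icc.inter_right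
    (isClosed_singleton.preimage hk) : IsCompact (Icc (0 : ℝ) 1 ∩ k ⁻¹' {b})).exists_isLeast (by
      obtain ⟨t, ht, h⟩ := intermediate_value_Icc zero_le_one hk.continuousOn
        (show b ∈ Icc (k 0) (k 1) from ⟨by linarith, by linarith⟩)
      exact ⟨t, ht, h⟩)
  have hkt₁ : k t₁ = b := hkt₁
  obtain ⟨t₀, ⟨ht₀, hkt₀⟩, hmax⟩ := (isCompact_Icc.inter_right
    (isClosed_singleton.preimage hk) : IsCompact (Icc (0 : ℝ) t₁ ∩ k ⁻¹' {a})).exists_isGreatest (by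
      obtain ⟨t, ht, h⟩ := intermediate_value_Icc ht₁.1 hk.continuousOn
        (show a ∈ Icc (k 0) (k t₁) from ⟨by linarith, by linarith⟩)
      exact ⟨t, ht, h⟩)
  have hkt₀ : k t₀ = a := hkt₀
  refine ⟨γ.extend t₀, γ.extend t₁, hkt₀, hkt₁, ?_⟩
  refine JoinedIn.ofLine (f := fun t => γ.extend (t₀ + t * (t₁ - t₀)))
    (Continuous.continuousOn (by fun_prop)) (by simp) (by simp) ?_
  rintro _ ⟨u, hu, rfl⟩
  change γ.extend (t₀ + u * (t₁ - t₀)) ∈ _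
  have hu0 : t₀ ≤ t₀ + u * (t₁ - t₀) := by nlinarith [hu.1, ht₀.2]
  have hu1 : t₀ + u * (t₁ - t₀) ≤ t₁ := by nlinarith [hu.2, ht₀.2]
  generalize t₀ + u * (t₁ - t₀) = t at hu0 hu1
  have ht01 : t ∈ Icc (0 : ℝ) 1 := ⟨ht₀.1.trans hu0, hu1.trans ht₁.2⟩
  refine ⟨?_, ?_, ?_⟩
  · rw [γ.extend_apply ht01]; exact hγ _
  · change a ≤ k t
    by_contra! hlt
    obtain ⟨t', ht', h'⟩ := intermediate_value_Icc hu1 hk.continuousOn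
      (show a ∈ Icc (k t) (k t₁) from ⟨hlt.le, by linarith⟩)
    have := hmax ⟨⟨ht01.1.trans ht'.1, ht'.2⟩, h'⟩
    have : t' = t := le_antisymm (by linarith) ht'.1
    subst this; linarith
  · change k t ≤ b
    by_contra! hlt
    obtain ⟨t', ht', h'⟩ := intermediate_value_Icc ht01.1 hk.continuousOn
      (show b ∈ Icc (k 0) (k t) from ⟨by linarith, hlt.le⟩)
    have := hmin ⟨⟨ht'.1, ht'.2.trans ht01.2⟩, h'⟩
    have : t' = t := le_antisymm ht'.2 (by linarith)
    subst this; linarith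

/-! ### Joining events -/

section Events

variable {E : Type} {L : LatticeOn E}

/-- The event that `A` and `B` are joined by an open path inside `S`. -/
def Joins (L : LatticeOn E) (S A B : Set Pt) : Set (Config E) :=
  {ω | ∃ x ∈ A, ∃ y ∈ B, JoinedIn (S ∩ openEdgeSet L ω) x y}

lemma crossingIn_iff {ω : Config E} {S A B : Set Pt} :
    CrossingIn L ω S A B ↔ ω ∈ Joins L S A B := by
  constructor
  · rintro ⟨γ, hγ, h0, h1, hS⟩
    exact ⟨_, h0, _, h1, JoinedIn.ofLine hγ rfl rfl (by rintro _ ⟨t, ht, rfl⟩; exact hS t ht)⟩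
  · rintro ⟨x, hx, y, hy, γ, hγ⟩
    exact ⟨γ.extend, γ.continuous_extend.continuousOn, by simpa using hx, by simpa using hy,
      fun t ht => by rw [γ.extend_apply ht]; exact hγ _⟩

lemma Joins.mono {S A B S' A' B' : Set Pt} (hS : S ⊆ S') (hA : A ⊆ A') (hB : B ⊆ B') :
    Joins L S A B ⊆ Joins L S' A' B' := by
  rintro ω ⟨x, hx, y, hy, h⟩
  exact ⟨x, hA hx, y, hB hy, h.mono (inter_subset_inter_left _ hS)⟩

lemma openEdgeSet_mono {ω ω' : Config E} (h : ∀ e, ω e = true → ω' e = true) :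
    openEdgeSet L ω ⊆ openEdgeSet L ω' :=
  biUnion_subset_biUnion_left h

lemma increasingEvent_joins (S A B : Set Pt) : IncreasingEvent (Joins L S A B) := by
  rintro ω ω' h ⟨x, hx, y, hy, hj⟩
  exact ⟨x, hx, y, hy, hj.mono (inter_subset_inter_right _ (openEdgeSet_mono h))⟩

/-- Only finitely many edges meet a given bounded set. -/
def IsLocallyFinite (L : LatticeOn E) : Prop :=
  ∀ S : Set Pt, Bornology.IsBounded S →
    {e | (segment ℝ (L.ends e).1 (L.ends e).2 ∩ S).Nonempty}.Finite

lemma measurableSet_of_finite_dependence {A : Set (Config E)} {F : Set E} (hF : F.Finite)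
    (h : ∀ ω ω' : Config E, (∀ e ∈ F, ω e = ω' e) → ω ∈ A → ω' ∈ A) : MeasurableSet A := by
  have : Finite F := hF
  let ρ : Config E → (F → Bool) := fun ω e => ω e
  have hρ : Measurable ρ := measurable_pi_lambda _ fun e => measurable_pi_apply _
  have hA : A = ρ ⁻¹' (ρ '' A) := by
    refine (subset_preimage_image ρ A).antisymm ?_
    rintro ω' ⟨ω, hω, hωω'⟩
    exact h ω ω' (fun e he => congrFun hωω' ⟨e, he⟩) hω
  rw [hA]
  exact hρ (Set.toFinite _).measurableSet

lemma measurableSet_joins (hL : IsLocallyFinite L) {S : Set Pt} (hS : Bornology.IsBounded S)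
    (A B : Set Pt) : MeasurableSet (Joins L S A B) := by
  refine measurableSet_of_finite_dependence (hL S hS) ?_
  rintro ω ω' h ⟨x, hx, y, hy, hj⟩
  refine ⟨x, hx, y, hy, hj.mono ?_⟩
  rintro z ⟨hz, hzω⟩
  obtain ⟨e, he, hze⟩ := mem_iUnion₂.1 hzω
  exact ⟨hz, mem_iUnion₂.2 ⟨e, (h e ⟨z, hze, hz⟩).symm.trans he, hze⟩⟩

/-- An axis-parallel rectangle. -/
def rect (x₁ x₂ y₁ y₂ : ℝ) : Set Pt :=
  {z | x₁ ≤ z.1 ∧ z.1 ≤ x₂ ∧ y₁ ≤ z.2 ∧ z.2 ≤ y₂}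

lemma isBounded_rect (x₁ x₂ y₁ y₂ : ℝ) : Bornology.IsBounded (rect x₁ x₂ y₁ y₂) :=
  (Metric.isBounded_Icc ((x₁, y₁) : Pt) (x₂, y₂)).subset
    fun _ hz => ⟨⟨hz.1, hz.2.2.1⟩, ⟨hz.2.1, hz.2.2.2⟩⟩

/-- Horizontal crossing of a rectangle. -/
def HX (L : LatticeOn E) (x₁ x₂ y₁ y₂ : ℝ) : Set (Config E) :=
  Joins L (rect x₁ x₂ y₁ y₂) {z | z.1 = x₁} {z | z.1 = x₂}

/-- Vertical crossing of a rectangle. -/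
def VX (L : LatticeOn E) (x₁ x₂ y₁ y₂ : ℝ) : Set (Config E) :=
  Joins L (rect x₁ x₂ y₁ y₂) {z | z.2 = y₁} {z | z.2 = y₂}

lemma ch_iff {m n : ℝ} {ω : Config E} : Ch L m n ω ↔ ω ∈ HX L (-m) m 0 n := by
  unfold Ch HX
  rw [crossingIn_iff]
  constructor
  · exact fun h => Joins.mono Subset.rfl (fun z hz => hz.1) (fun z hz => hz.1) h
  · rintro ⟨x, hx, y, hy, h⟩
    exact ⟨x, ⟨hx, h.source_mem.1.2.2⟩, y, ⟨hy, h.target_mem.1.2.2⟩, h⟩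

lemma cv_iff {m n : ℝ} {ω : Config E} : Cv L m n ω ↔ ω ∈ VX L (-m) m 0 n := by
  unfold Cv VX
  rw [crossingIn_iff]
  constructor
  · exact fun h => Joins.mono Subset.rfl (fun z hz => hz.1) (fun z hz => hz.1) h
  · rintro ⟨x, hx, y, hy, h⟩
    exact ⟨x, ⟨hx, h.source_mem.1.1, h.source_mem.1.2.1⟩, y,
      ⟨hy, h.target_mem.1.1, h.target_mem.1.2.1⟩, h⟩

lemma HX_subset {x₁ x₂ y₁ y₂ x₁' x₂' y₁' y₂' : ℝ} (h₁ : x₁ ≤ x₁') (h : x₁' ≤ x₂') (h₂ : x₂' ≤ x₂)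
    (h₃ : y₁' ≤ y₁) (h₄ : y₂ ≤ y₂') : HX L x₁ x₂ y₁ y₂ ⊆ HX L x₁' x₂' y₁' y₂' := by
  rintro ω ⟨x, rfl, y, rfl, hj⟩
  obtain ⟨x', y', hx', hy', hj'⟩ := hj.exists_between continuous_fst h h₁ h₂
  exact ⟨x', hx', y', hy', hj'.mono fun z hz =>
    ⟨⟨hz.2.1, hz.2.2, h₃.trans hz.1.1.2.2.1, hz.1.1.2.2.2.trans h₄⟩, hz.1.2⟩⟩

lemma VX_subset {x₁ x₂ y₁ y₂ x₁' x₂' y₁' y₂' : ℝ} (h₁ : y₁ ≤ y₁') (h : y₁' ≤ y₂') (h₂ : y₂' ≤ y₂)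
    (h₃ : x₁' ≤ x₁) (h₄ : x₂ ≤ x₂') : VX L x₁ x₂ y₁ y₂ ⊆ VX L x₁' x₂' y₁' y₂' := by
  rintro ω ⟨x, rfl, y, rfl, hj⟩
  obtain ⟨x', y', hx', hy', hj'⟩ := hj.exists_between continuous_snd h h₁ h₂
  exact ⟨x', hx', y', hy', hj'.mono fun z hz =>
    ⟨⟨h₃.trans hz.1.1.1, hz.1.1.2.1.trans h₄, hz.2.1, hz.2.2⟩, hz.1.2⟩⟩

/-- Two overlapping vertical crossings are linked by a horizontal crossing of the overlap. -/
lemma VX_glue {x₁ x₂ y₁ y₂ y₃ y₄ : ℝ} {ω : Config E} (h₁₂ : y₁ ≤ y₂) (h₃₄ : y₃ ≤ y₄)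
    (h₁ : ω ∈ VX L x₁ x₂ y₁ y₃) (h₂ : ω ∈ VX L x₁ x₂ y₂ y₄) (h : ω ∈ HX L x₁ x₂ y₂ y₃) :
    ω ∈ VX L x₁ x₂ y₁ y₄ := by
  obtain ⟨a, ha, b, hb, hab⟩ := h₁
  obtain ⟨c, hc, d, hd, hcd⟩ := h₂
  obtain ⟨u, hu, v, hv, huv⟩ := h
  have h₂₃ : y₂ ≤ y₃ := huv.source_mem.1.2.2.1.trans huv.source_mem.1.2.2.2
  simp only [mem_ofPred_eq] at ha hb hc hd hu hv
  let F := rect x₁ x₂ y₁ y₄ ∩ openEdgeSet L ω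
  have s₁ : rect x₁ x₂ y₁ y₃ ∩ openEdgeSet L ω ⊆ F := fun z hz =>
    ⟨⟨hz.1.1, hz.1.2.1, hz.1.2.2.1, hz.1.2.2.2.trans h₃₄⟩, hz.2⟩
  have s₂ : rect x₁ x₂ y₂ y₄ ∩ openEdgeSet L ω ⊆ F := fun z hz =>
    ⟨⟨hz.1.1, hz.1.2.1, h₁₂.trans hz.1.2.2.1, hz.1.2.2.2⟩, hz.2⟩
  have s₃ : rect x₁ x₂ y₂ y₃ ∩ openEdgeSet L ω ⊆ F := fun z hz =>
    ⟨⟨hz.1.1, hz.1.2.1, h₁₂.trans hz.1.2.2.1, hz.1.2.2.2.trans h₃₄⟩, hz.2⟩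
  have j₁ : JoinedIn F u a := huv.of_crossing hab s₃ s₁
    (fun z hz => ⟨by linarith [hz.1.2.2.1], by linarith [hz.1.2.2.2]⟩)
    (fun z hz => ⟨by linarith [hz.1.1], by linarith [hz.1.2.1]⟩)
  have j₂ : JoinedIn F u c := huv.of_crossing hcd s₃ s₂
    (fun z hz => ⟨by linarith [hz.1.2.2.1], by linarith [hz.1.2.2.2]⟩)
    (fun z hz => ⟨by linarith [hz.1.1], by linarith [hz.1.2.1]⟩)
  exact ⟨a, ha, d, hd, (j₁.symm.trans j₂).trans (hcd.mono s₂)⟩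

/-! ### Chains of crossings along a polygonal line -/

/-- Both crossings of the two perpendicular `6 * r` by `2 * r` boxes centred at `p`. -/
def Cross (L : LatticeOn E) (r : ℝ) (p : Pt) : Set (Config E) :=
  HX L (p.1 - 3 * r) (p.1 + 3 * r) (p.2 - r) (p.2 + r) ∩
    VX L (p.1 - r) (p.1 + r) (p.2 - 3 * r) (p.2 + 3 * r)

/-- The closed Euclidean disc. -/
def disc (p : Pt) (ρ : ℝ) : Set Pt := {z | (z.1 - p.1) ^ 2 + (z.2 - p.2) ^ 2 ≤ ρ ^ 2}

lemma rect_subset_disc {r : ℝ} (hr : 0 ≤ r) (p : Pt) :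
    rect (p.1 - 3 * r) (p.1 + 3 * r) (p.2 - r) (p.2 + r) ⊆ disc p (4 * r) := by
  rintro z ⟨h₁, h₂, h₃, h₄⟩
  simp only [disc, mem_ofPred_eq]
  nlinarith

lemma rect_subset_disc' {r : ℝ} (hr : 0 ≤ r) (p : Pt) :
    rect (p.1 - r) (p.1 + r) (p.2 - 3 * r) (p.2 + 3 * r) ⊆ disc p (4 * r) := by
  rintro z ⟨h₁, h₂, h₃, h₄⟩
  simp only [disc, mem_ofPred_eq]
  nlinarith

/-- Crosses centred at nearby consecutive points are connected to each other. -/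
lemma joins_of_chain {r : ℝ} (hr : 0 ≤ r) (p : ℕ → Pt) (n : ℕ)
    (h₁ : ∀ k, |(p (k + 1)).1 - (p k).1| ≤ r) (h₂ : ∀ k, |(p (k + 1)).2 - (p k).2| ≤ r)
    {ω : Config E} (hω : ∀ k ≤ n, ω ∈ Cross L r (p k)) :
    ω ∈ Joins L {z | ∃ k ≤ n, z ∈ disc (p k) (4 * r)} (disc (p 0) (4 * r))
      (disc (p n) (4 * r)) := by
  set T : Set Pt := {z | ∃ k ≤ n, z ∈ disc (p k) (4 * r)}
  have hH : ∀ k ≤ n, ∃ a b : Pt, a.1 = (p k).1 - 3 * r ∧ b.1 = (p k).1 + 3 * r ∧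
      JoinedIn (rect ((p k).1 - 3 * r) ((p k).1 + 3 * r) ((p k).2 - r) ((p k).2 + r) ∩
        openEdgeSet L ω) a b := fun k hk => by
    obtain ⟨a, ha, b, hb, h⟩ := (hω k hk).1
    exact ⟨a, b, ha, hb, h⟩
  choose! a b ha hb hab using hH
  have sH : ∀ k ≤ n, rect ((p k).1 - 3 * r) ((p k).1 + 3 * r) ((p k).2 - r) ((p k).2 + r) ∩
      openEdgeSet L ω ⊆ T ∩ openEdgeSet L ω := fun k hk =>
    inter_subset_inter_left _ fun z hz => ⟨k, hk, rect_subset_disc hr _ hz⟩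
  have key : ∀ k ≤ n, JoinedIn (T ∩ openEdgeSet L ω) (a 0) (a k) := by
    intro k
    induction k with
    | zero => exact fun h => JoinedIn.refl (sH 0 h (hab 0 h).source_mem)
    | succ k ih =>
      intro hk
      have hk' : k ≤ n := by omega
      obtain ⟨c, hc, d, hd, hcd⟩ := (hω (k + 1) hk).2
      simp only [mem_ofPred_eq] at hc hd
      have sV : rect ((p (k + 1)).1 - r) ((p (k + 1)).1 + r) ((p (k + 1)).2 - 3 * r)
          ((p (k + 1)).2 + 3 * r) ∩ openEdgeSet L ω ⊆ T ∩ openEdgeSet L ω :=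
        inter_subset_inter_left _ fun z hz => ⟨k + 1, hk, rect_subset_disc' hr _ hz⟩
      have e₁ := abs_le.1 (h₁ k)
      have e₂ := abs_le.1 (h₂ k)
      have j₁ := (hab k hk').of_crossing hcd (sH k hk') sV
        (fun z hz => ⟨by linarith [hz.1.2.2.1], by linarith [hz.1.2.2.2]⟩)
        (fun z hz => ⟨by linarith [hz.1.1, ha k hk'], by linarith [hz.1.2.1, hb k hk']⟩)
      have j₂ := (hab (k + 1) hk).of_crossing hcd (sH (k + 1) hk) sV
        (fun z hz => ⟨by linarith [hz.1.2.2.1], by linarith [hz.1.2.2.2]⟩)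
        (fun z hz => ⟨by linarith [hz.1.1, ha (k + 1) hk], by linarith [hz.1.2.1, hb (k + 1) hk]⟩)
      exact (ih hk').trans (j₁.trans j₂.symm)
  exact ⟨a 0, rect_subset_disc hr _ (hab 0 (Nat.zero_le n)).source_mem.1,
    a n, rect_subset_disc hr _ (hab n le_rfl).source_mem.1, key n le_rfl⟩

/-- A chain of crosses from `A` to `B` crosses a strip in the direction of the linear
functional `(c, s)`. -/
lemma joins_of_strip {r c s e c' s' e' h m : ℝ} (hr : 0 ≤ r) (hh : 0 ≤ h) (hcs : c ^ 2 + s ^ 2 = 1)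
    (hcs' : c' ^ 2 + s' ^ 2 = 1) {A B : Pt} {n : ℕ} (hn : 0 < n)
    (hA : c * A.1 + s * A.2 + e = -(4 * r)) (hB : c * B.1 + s * B.2 + e = h + 4 * r)
    (hA' : c' * A.1 + s' * A.2 + e' = m) (hB' : c' * B.1 + s' * B.2 + e' = m)
    (h₁ : |B.1 - A.1| ≤ n * r) (h₂ : |B.2 - A.2| ≤ n * r)
    {ω : Config E} (hω : ∀ k ≤ n, ω ∈ Cross L r (A + ((k : ℝ) / n) • (B - A))) :
    ω ∈ Joins L {z | (0 ≤ c * z.1 + s * z.2 + e ∧ c * z.1 + s * z.2 + e ≤ h) ∧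
        |c' * z.1 + s' * z.2 + e' - m| ≤ 4 * r}
      {z | c * z.1 + s * z.2 + e = 0} {z | c * z.1 + s * z.2 + e = h} := by
  have hn' : (0 : ℝ) < n := by exact_mod_cast hn
  have lip : ∀ {c s : ℝ}, c ^ 2 + s ^ 2 = 1 → ∀ e : ℝ, ∀ {p z : Pt}, z ∈ disc p (4 * r) →
      |(c * z.1 + s * z.2 + e) - (c * p.1 + s * p.2 + e)| ≤ 4 * r := by
    intro c s hcs e p z hz
    simp only [disc, mem_ofPred_eq] at hz
    refine abs_le_of_sq_le_sq (le_trans ?_ hz) (by linarith)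
    nlinarith [sq_nonneg (c * (z.2 - p.2) - s * (z.1 - p.1))]
  have step : ∀ x y : ℝ, |y| ≤ n * r → ∀ k : ℕ,
      |(x + ((k + 1 : ℕ) : ℝ) / n * y) - (x + (k : ℝ) / n * y)| ≤ r := by
    intro x y hy k
    have : (x + ((k + 1 : ℕ) : ℝ) / n * y) - (x + (k : ℝ) / n * y) = y / n := by
      push_cast; field_simp; ring
    rw [this, abs_div, abs_of_pos hn', div_le_iff₀ hn']
    linarith
  obtain ⟨x, hx, y, hy, hj⟩ := joins_of_chain (L := L) hr
    (fun k => A + ((k : ℝ) / n) • (B - A)) n (fun k => by simpa using step A.1 _ h₁ k)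
    (fun k => by simpa using step A.2 _ h₂ k) hω
  have hx' := abs_le.1 (lip hcs e hx)
  have hy' := abs_le.1 (lip hcs e hy)
  simp only [Nat.cast_zero, zero_div, zero_smul, add_zero, div_self hn'.ne', one_smul,
    add_sub_cancel] at hx' hy'
  obtain ⟨x', y', hx₀, hy₀, hj'⟩ := hj.exists_between
    (φ := fun z => c * z.1 + s * z.2 + e) (by fun_prop) hh (by linarith) (by linarith)
  refine ⟨x', hx₀, y', hy₀, hj'.mono ?_⟩
  rintro z ⟨⟨⟨k, hk, hz⟩, hzω⟩, hz'⟩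
  refine ⟨⟨hz', ?_⟩, hzω⟩
  have := lip hcs' e' hz
  convert this using 3
  simp only [Prod.fst_add, Prod.snd_add, Prod.smul_fst, Prod.smul_snd, Prod.fst_sub,
    Prod.snd_sub, smul_eq_mul]
  linear_combination (k / n - 1 : ℝ) * hA' - (k / n : ℝ) * hB'

/-! ### Invariance under lattice translations -/

lemma mem_openEdgeSet_shift {σ : E → E} (hσ : Function.Surjective σ) {v : Pt}
    (hv : ∀ e, L.ends (σ e) = ((L.ends e).1 + v, (L.ends e).2 + v)) (ω : Config E) (z : Pt) :
    z + v ∈ openEdgeSet L ω ↔ z ∈ openEdgeSet L (ω ∘ σ) := by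
  have key : ∀ e, z + v ∈ segment ℝ (L.ends (σ e)).1 (L.ends (σ e)).2 ↔
      z ∈ segment ℝ (L.ends e).1 (L.ends e).2 := fun e => by
    rw [hv, add_comm z, add_comm _ v, add_comm _ v]
    exact mem_segment_translate ℝ v
  simp only [openEdgeSet, mem_iUnion, exists_prop]
  constructor
  · rintro ⟨e, he, hz⟩
    obtain ⟨e, rfl⟩ := hσ e
    exact ⟨e, he, (key e).1 hz⟩
  · rintro ⟨e, he, hz⟩
    exact ⟨σ e, he, (key e).2 hz⟩

/-- The set `S - v`. -/
def shift (v : Pt) (S : Set Pt) : Set Pt := {z | z + v ∈ S}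

lemma shift_zero (S : Set Pt) : shift 0 S = S := by
  ext z; simp [shift]

lemma shift_shift (v w : Pt) (S : Set Pt) : shift w (shift v S) = shift (v + w) S := by
  ext z; simp [shift, add_assoc, add_comm v]

lemma isBounded_shift (v : Pt) {S : Set Pt} (hS : Bornology.IsBounded S) :
    Bornology.IsBounded (shift v S) := by
  refine ((isometry_add_left (-v)).lipschitz.isBounded_image hS).subset fun z hz => ?_
  exact ⟨z + v, hz, by simp⟩

lemma joins_shift {σ : E → E} (hσ : Function.Surjective σ) {v : Pt}
    (hv : ∀ e, L.ends (σ e) = ((L.ends e).1 + v, (L.ends e).2 + v)) (ω : Config E)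
    (S A B : Set Pt) :
    ω ∘ σ ∈ Joins L (shift v S) (shift v A) (shift v B) ↔ ω ∈ Joins L S A B := by
  constructor
  · rintro ⟨x, hx, y, hy, hj⟩
    refine ⟨x + v, hx, y + v, hy, (hj.map (continuous_add_const v)).mono ?_⟩
    rintro _ ⟨z, hz, rfl⟩
    exact ⟨hz.1, (mem_openEdgeSet_shift hσ hv ω z).2 hz.2⟩
  · rintro ⟨x, hx, y, hy, hj⟩
    refine ⟨x - v, by simpa [shift] using hx, y - v, by simpa [shift] using hy,
      (hj.map (continuous_id.sub continuous_const)).mono ?_⟩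
    rintro _ ⟨z, hz, rfl⟩
    exact ⟨by simpa [shift] using hz.1,
      (mem_openEdgeSet_shift hσ hv ω _).1 (by simpa using hz.2)⟩

/-- The translations that preserve the probabilities of joining events. -/
def translations (L : LatticeOn E) (P : Measure (Config E)) : AddSubgroup Pt where
  carrier := {v | ∀ S A B, Bornology.IsBounded S →
    P (Joins L (shift v S) (shift v A) (shift v B)) = P (Joins L S A B)}
  zero_mem' := fun S A B _ => by simp only [shift_zero]
  add_mem' := fun {v w} hv hw S A B hS => by
    rw [← hv S A B hS, ← hw _ _ _ (isBounded_shift v hS)]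
    simp only [shift_shift]
  neg_mem' := fun {v} hv S A B hS => by
    rw [← hv _ _ _ (isBounded_shift (-v) hS)]
    simp only [shift_shift, neg_add_cancel, shift_zero]

lemma mem_translations {P : Measure (Config E)} (hL : IsLocallyFinite L) {σ : E → E}
    (hσ : Function.Surjective σ) {v : Pt}
    (hv : ∀ e, L.ends (σ e) = ((L.ends e).1 + v, (L.ends e).2 + v))
    (hP : TranslationInvariantUnder P σ) : v ∈ translations L P := by
  intro S A B hS
  have hm : Measurable fun ω : Config E => ω ∘ σ :=
    measurable_pi_lambda _ fun e => measurable_pi_apply _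
  conv_lhs => rw [← hP]
  rw [Measure.map_apply hm (measurableSet_joins hL (isBounded_shift v hS) _ _)]
  congr 1
  ext ω
  exact joins_shift hσ hv ω S A B

lemma measure_HX_translate {P : Measure (Config E)} {v : Pt} (hv : v ∈ translations L P)
    (x₁ x₂ y₁ y₂ : ℝ) :
    P (HX L (v.1 + x₁) (v.1 + x₂) (v.2 + y₁) (v.2 + y₂)) = P (HX L x₁ x₂ y₁ y₂) := by
  rw [HX, ← hv _ _ _ (isBounded_rect _ _ _ _)]
  simp [HX, shift, rect, add_comm v.1, add_comm v.2]

lemma measure_VX_translate {P : Measure (Config E)} {v : Pt} (hv : v ∈ translations L P)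
    (x₁ x₂ y₁ y₂ : ℝ) :
    P (VX L (v.1 + x₁) (v.1 + x₂) (v.2 + y₁) (v.2 + y₂)) = P (VX L x₁ x₂ y₁ y₂) := by
  rw [VX, ← hv _ _ _ (isBounded_rect _ _ _ _)]
  simp [VX, shift, rect, add_comm v.1, add_comm v.2]

/-- Every point of the plane is within distance `d` of some translation in the group `G`. -/
def IsDense (G : AddSubgroup Pt) (d : ℝ) : Prop :=
  ∀ p : Pt, ∃ v ∈ G, |v.1 - p.1| ≤ d ∧ |v.2 - p.2| ≤ d

lemma exists_zsmul_near {a : ℝ} (ha : 0 < a) (x : ℝ) : ∃ k : ℤ, |k * a - x| ≤ a := by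
  refine ⟨⌊x / a⌋, ?_⟩
  have h₁ := Int.floor_le (x / a)
  have h₂ := Int.lt_floor_add_one (x / a)
  rw [le_div_iff₀ ha] at h₁
  rw [div_lt_iff₀ ha] at h₂
  rw [abs_le]
  constructor <;> linarith

lemma isDense_of_mem {G : AddSubgroup Pt} {a b : ℝ} (ha : 0 < a) (hb : 0 < b)
    (h₁ : ((a, 0) : Pt) ∈ G) (h₂ : ((0, b) : Pt) ∈ G) : IsDense G (max a b) := by
  intro p
  obtain ⟨k, hk⟩ := exists_zsmul_near ha p.1
  obtain ⟨l, hl⟩ := exists_zsmul_near hb p.2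
  refine ⟨_, G.add_mem (G.zsmul_mem h₁ k) (G.zsmul_mem h₂ l), ?_, ?_⟩
  · simpa using hk.trans (le_max_left a b)
  · simpa using hl.trans (le_max_right a b)

/-! ### Probability bounds -/

lemma IncreasingEvent.inter {A B : Set (Config E)} (hA : IncreasingEvent A)
    (hB : IncreasingEvent B) : IncreasingEvent (A ∩ B) :=
  fun ω ω' h hω => ⟨hA ω ω' h hω.1, hB ω ω' h hω.2⟩

lemma PositivelyAssociated.pow_le {P : Measure (Config E)} [IsProbabilityMeasure P]
    (hP : PositivelyAssociated P) {A : ℕ → Set (Config E)} (hm : ∀ k, MeasurableSet (A k))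
    (hi : ∀ k, IncreasingEvent (A k)) {δ : ENNReal} (hδ : ∀ k, δ ≤ P (A k)) (n : ℕ) :
    δ ^ n ≤ P {ω | ∀ k < n, ω ∈ A k} := by
  induction n with
  | zero => simp
  | succ n ih =>
    have hmeas : MeasurableSet {ω | ∀ k < n, ω ∈ A k} := by
      have : {ω | ∀ k < n, ω ∈ A k} = ⋂ k, ⋂ (_ : k < n), A k := by ext; simp
      rw [this]
      exact MeasurableSet.iInter fun k => MeasurableSet.iInter fun _ => hm k
    have hinc : IncreasingEvent {ω | ∀ k < n, ω ∈ A k} := fun ω ω' h hω k hk =>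
      hi k ω ω' h (hω k hk)
    calc δ ^ (n + 1) = δ ^ n * δ := pow_succ _ _
      _ ≤ P {ω | ∀ k < n, ω ∈ A k} * P (A n) := mul_le_mul' ih (hδ n)
      _ ≤ P ({ω | ∀ k < n, ω ∈ A k} ∩ A n) := hP _ _ hmeas (hm n) hinc (hi n)
      _ ≤ P {ω | ∀ k < n + 1, ω ∈ A k} := measure_mono fun ω hω k hk => by
        rcases Nat.lt_succ_iff_lt_or_eq.1 hk with h | rfl
        exacts [hω.1 k h, hω.2]

/-- Horizontal crossings of large boxes of aspect ratio `K`, at any position, have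
probability bounded away from `0`. -/
def HBound (L : LatticeOn E) (P : Measure (Config E)) (K : ℝ) : Prop :=
  ∃ δ : ENNReal, 0 < δ ∧ ∃ r₀ : ℝ, ∀ r, r₀ ≤ r → ∀ p : Pt,
    δ ≤ P (HX L (p.1 - K * r) (p.1 + K * r) (p.2 - r) (p.2 + r))

/-- Vertical crossings of large boxes of width `2 * r` and height `κ * r`, at any position, have
probability bounded away from `0`. -/
def VBound (L : LatticeOn E) (P : Measure (Config E)) (κ : ℝ) : Prop :=
  ∃ δ : ENNReal, 0 < δ ∧ ∃ r₀ : ℝ, ∀ r, r₀ ≤ r → ∀ p : Pt,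
    δ ≤ P (VX L (p.1 - r) (p.1 + r) p.2 (p.2 + κ * r))

lemma hBound_of_ch {P : Measure (Config E)} {d : ℝ} (hd : IsDense (translations L P) d)
    (h : ∀ α : ℝ, 0 < α → ∃ δ : ℝ, 0 < δ ∧ ∃ N₀ : ℕ, ∀ N : ℕ, N₀ ≤ N →
      ENNReal.ofReal δ < P {ω | Ch L (α * N) N ω}) {K : ℝ} (hK : 0 < K) : HBound L P K := by
  obtain ⟨δ, hδ, N₀, hN₀⟩ := h (2 * K + 2) (by linarith)
  refine ⟨ENNReal.ofReal δ, by simpa using hδ, max 2 (max (2 * d) (2 * N₀)), fun r hr p => ?_⟩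
  simp only [max_le_iff] at hr
  obtain ⟨hr2, hrd, hrN⟩ := hr
  obtain ⟨v, hv, h₁, h₂⟩ := hd (p.1, p.2 - r + d)
  have f₁ : (⌊r⌋₊ : ℝ) ≤ r := Nat.floor_le (by linarith)
  have f₂ : r < (⌊r⌋₊ : ℝ) + 1 := Nat.lt_floor_add_one r
  have hN : N₀ ≤ ⌊r⌋₊ := Nat.le_floor (by linarith [(Nat.cast_nonneg N₀ : (0 : ℝ) ≤ N₀)])
  have hP := (hN₀ _ hN).le
  simp only [ch_iff, ofPred_mem_eq] at hP
  rw [← measure_HX_translate hv] at hP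
  rw [abs_le] at h₁ h₂
  simp only at h₁ h₂
  have hw : K * r + d ≤ (2 * K + 2) * (⌊r⌋₊ : ℝ) := by nlinarith
  have hKr : 0 ≤ K * r := by positivity
  exact hP.trans (measure_mono
    (HX_subset (by linarith) (by linarith) (by linarith) (by linarith) (by linarith)))

lemma exists_vBound_of_cv {P : Measure (Config E)} {d : ℝ} (hd : IsDense (translations L P) d)
    (h : ∃ β δ : ℝ, 0 < β ∧ 0 < δ ∧ ∃ N₀ : ℕ, ∀ N : ℕ, N₀ ≤ N →
      ENNReal.ofReal δ < P {ω | Cv L (N : ℝ) (β * N) ω}) : ∃ κ, 0 < κ ∧ VBound L P κ := by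
  obtain ⟨β, δ, hβ, hδ, N₀, hN₀⟩ := h
  refine ⟨β / 8, by positivity, ENNReal.ofReal δ, by simpa using hδ,
    max 4 (max (2 * d) (max (2 * N₀) (16 * d / β))), fun r hr p => ?_⟩
  simp only [max_le_iff] at hr
  obtain ⟨hr4, hrd, hrN, hrβ⟩ := hr
  rw [div_le_iff₀ hβ] at hrβ
  obtain ⟨v, hv, h₁, h₂⟩ := hd (p.1, p.2 - d)
  have f₁ : (⌊r / 2⌋₊ : ℝ) ≤ r / 2 := Nat.floor_le (by linarith)
  have f₂ : r / 2 < (⌊r / 2⌋₊ : ℝ) + 1 := Nat.lt_floor_add_one _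
  have hN : N₀ ≤ ⌊r / 2⌋₊ := Nat.le_floor (by linarith)
  have hP := (hN₀ _ hN).le
  simp only [cv_iff, ofPred_mem_eq] at hP
  rw [← measure_VX_translate hv] at hP
  rw [abs_le] at h₁ h₂
  simp only at h₁ h₂
  have hw : β / 8 * r + 2 * d ≤ β * (⌊r / 2⌋₊ : ℝ) := by nlinarith
  have hβr : 0 ≤ β / 8 * r := by positivity
  exact hP.trans (measure_mono
    (VX_subset (by linarith) (by linarith) (by linarith) (by linarith) (by linarith)))

lemma VBound.mono {P : Measure (Config E)} {κ κ' : ℝ} (h : VBound L P κ) (hκ' : 0 ≤ κ')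
    (hκ : κ' ≤ κ) : VBound L P κ' := by
  obtain ⟨δ, hδ, r₀, h⟩ := h
  refine ⟨δ, hδ, max r₀ 0, fun r hr p => (h r ((le_max_left _ _).trans hr) p).trans ?_⟩
  have hr0 : 0 ≤ r := (le_max_right _ _).trans hr
  have h₁ : 0 ≤ κ' * r := by positivity
  have h₂ : κ' * r ≤ κ * r := by gcongr
  exact measure_mono
    (VX_subset le_rfl (by linarith) (by linarith) le_rfl le_rfl)

lemma VBound.extend {P : Measure (Config E)} (hL : IsLocallyFinite L)
    (hP : PositivelyAssociated P) (hH : ∀ K, 0 < K → HBound L P K) {κ : ℝ} (hκ : 0 < κ)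
    (h : VBound L P κ) : VBound L P (3 / 2 * κ) := by
  obtain ⟨δ, hδ, r₀, h⟩ := h
  obtain ⟨δ', hδ', r₀', h'⟩ := hH (4 / κ) (by positivity)
  refine ⟨δ * δ * δ', by positivity, max 0 (max r₀ (4 * r₀' / κ)), fun r hr p => ?_⟩
  simp only [max_le_iff] at hr
  obtain ⟨hr0, hr, hr'⟩ := hr
  rw [div_le_iff₀ hκ] at hr'
  have h₁ := h r hr p
  have h₂ := h r hr (p.1, p.2 + κ / 2 * r)
  have h₃ := h' (κ / 4 * r) (by linarith) (p.1, p.2 + κ * (3 / 4) * r)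
  have e₁ : 4 / κ * (κ / 4 * r) = r := by field_simp
  have e₂ : p.2 + κ * (3 / 4) * r - κ / 4 * r = p.2 + κ / 2 * r := by ring
  have e₃ : p.2 + κ * (3 / 4) * r + κ / 4 * r = p.2 + κ * r := by ring
  have e₄ : p.2 + κ / 2 * r + κ * r = p.2 + 3 / 2 * κ * r := by ring
  simp only [e₁, e₂, e₃] at h₃
  simp only [e₄] at h₂
  have hκr : 0 ≤ κ * r := by positivity
  have m := fun x₁ x₂ y₁ y₂ A B =>
    measurableSet_joins hL (isBounded_rect x₁ x₂ y₁ y₂) A B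
  have i := fun S A B => increasingEvent_joins (L := L) S A B
  calc δ * δ * δ' ≤ P (VX L (p.1 - r) (p.1 + r) p.2 (p.2 + κ * r)) *
        P (VX L (p.1 - r) (p.1 + r) (p.2 + κ / 2 * r) (p.2 + 3 / 2 * κ * r)) *
        P (HX L (p.1 - r) (p.1 + r) (p.2 + κ / 2 * r) (p.2 + κ * r)) :=
        mul_le_mul' (mul_le_mul' h₁ h₂) h₃
    _ ≤ P (VX L (p.1 - r) (p.1 + r) p.2 (p.2 + κ * r) ∩
        VX L (p.1 - r) (p.1 + r) (p.2 + κ / 2 * r) (p.2 + 3 / 2 * κ * r)) *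
        P (HX L (p.1 - r) (p.1 + r) (p.2 + κ / 2 * r) (p.2 + κ * r)) := by
        gcongr
        exact hP _ _ (m ..) (m ..) (i _ _ _) (i _ _ _)
    _ ≤ _ := hP _ _ ((m ..).inter (m ..)) (m ..) ((i _ _ _).inter (i _ _ _)) (i _ _ _)
    _ ≤ _ := measure_mono fun ω hω =>
        VX_glue (by linarith) (by linarith) hω.1.1 hω.1.2 hω.2

lemma vBound_of_exists {P : Measure (Config E)} (hL : IsLocallyFinite L)
    (hP : PositivelyAssociated P) (hH : ∀ K, 0 < K → HBound L P K)
    (h : ∃ κ, 0 < κ ∧ VBound L P κ) {κ' : ℝ} (hκ' : 0 ≤ κ') : VBound L P κ' := by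
  obtain ⟨κ, hκ, h⟩ := h
  have hn : ∀ n : ℕ, VBound L P ((3 / 2) ^ n * κ) := by
    intro n
    induction n with
    | zero => simpa using h
    | succ n ih =>
      rw [pow_succ', mul_assoc]
      exact ih.extend hL hP hH (by positivity)
  obtain ⟨n, hn'⟩ := pow_unbounded_of_one_lt (κ' / κ) (by norm_num : (1 : ℝ) < 3 / 2)
  rw [div_lt_iff₀ hκ] at hn'
  exact (hn n).mono hκ' hn'.le

lemma exists_cross_bound {P : Measure (Config E)} (hL : IsLocallyFinite L)
    (hP : PositivelyAssociated P) (hH : HBound L P 3) (hV : VBound L P 6) :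
    ∃ δ : ENNReal, 0 < δ ∧ ∃ r₀ : ℝ, ∀ r, r₀ ≤ r → ∀ p : Pt, δ ≤ P (Cross L r p) := by
  obtain ⟨δ, hδ, r₀, h⟩ := hH
  obtain ⟨δ', hδ', r₀', h'⟩ := hV
  refine ⟨δ * δ', by positivity, max r₀ r₀', fun r hr p => ?_⟩
  have h₁ := h r ((le_max_left _ _).trans hr) p
  have h₂ := h' r ((le_max_right _ _).trans hr) (p.1, p.2 - 3 * r)
  have e : p.2 - 3 * r + 6 * r = p.2 + 3 * r := by ring
  simp only [e] at h₂
  exact (mul_le_mul' h₁ h₂).trans (hP _ _ (measurableSet_joins hL (isBounded_rect ..) ..)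
    (measurableSet_joins hL (isBounded_rect ..) ..) (increasingEvent_joins _ _ _)
    (increasingEvent_joins _ _ _))

lemma measurableSet_cross (hL : IsLocallyFinite L) (r : ℝ) (p : Pt) :
    MeasurableSet (Cross L r p) :=
  (measurableSet_joins hL (isBounded_rect ..) ..).inter
    (measurableSet_joins hL (isBounded_rect ..) ..)

lemma increasingEvent_cross (r : ℝ) (p : Pt) : IncreasingEvent (Cross L r p) :=
  (increasingEvent_joins _ _ _).inter (increasingEvent_joins _ _ _)

/-! ### Crossings of rotated boxes -/

/-- The preimage of `z` under `fun z => rot θ z + t`. -/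
noncomputable def rotTransInv (θ : ℝ) (t z : Pt) : Pt :=
  (Real.cos θ * z.1 + Real.sin θ * z.2 + -(Real.cos θ * t.1 + Real.sin θ * t.2),
    -Real.sin θ * z.1 + Real.cos θ * z.2 + (Real.sin θ * t.1 - Real.cos θ * t.2))

lemma rot_rotTransInv_add (θ : ℝ) (t z : Pt) : rot θ (rotTransInv θ t z) + t = z := by
  have h := Real.sin_sq_add_cos_sq θ
  refine Prod.ext ?_ ?_
  · simp only [rot, rotTransInv, Prod.fst_add]
    linear_combination (z.1 - t.1) * h
  · simp only [rot, rotTransInv, Prod.snd_add]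
    linear_combination (z.2 - t.2) * h

lemma isBounded_rotTrans_stdRect (θ : ℝ) (t : Pt) (h l : ℝ) :
    Bornology.IsBounded ((fun z => rot θ z + t) '' stdRect h l) := by
  have hb : stdRect h l ⊆ Icc ((0, 0) : Pt) (h, l) := fun _ hz =>
    ⟨⟨hz.1, hz.2.2.1⟩, ⟨hz.2.1, hz.2.2.2⟩⟩
  have hc : Continuous fun z : Pt => rot θ z + t := by unfold rot; fun_prop
  exact (isCompact_Icc.image hc).isBounded.subset (image_mono hb)

/-- The vertices of the chain from `A` to `B` with `n` steps. -/
noncomputable def chainPt (A B : Pt) (n k : ℕ) : Pt := A + ((k : ℝ) / n) • (B - A)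

lemma measure_chain_ge {P : Measure (Config E)} [IsProbabilityMeasure P]
    (hL : IsLocallyFinite L) (hP : PositivelyAssociated P) {δ : ENNReal} {r : ℝ}
    (hδ : ∀ p : Pt, δ ≤ P (Cross L r p)) (A B : Pt) (n : ℕ) :
    δ ^ (n + 1) ≤ P {ω | ∀ k ≤ n, ω ∈ Cross L r (chainPt A B n k)} := by
  simpa only [Nat.lt_succ_iff] using hP.pow_le (A := fun k => Cross L r (chainPt A B n k))
    (fun k => measurableSet_cross hL _ _) (fun k => increasingEvent_cross _ _)
    (fun k => hδ _) (n + 1)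

lemma abs_mul_le_of_sq {c x y : ℝ} (hc : c ^ 2 ≤ 1) (hx : 0 ≤ x) (hxy : x ≤ y) :
    |c * x| ≤ y := by
  rw [abs_mul, abs_of_nonneg hx]
  exact (mul_le_of_le_one_left hx (abs_le_one_iff_mul_self_le_one.2 (by nlinarith))).trans hxy

lemma leftRight_of_chain (θ : ℝ) (t : Pt) {h l r : ℝ} {n : ℕ} (hr : 0 ≤ r) (hh : 0 ≤ h)
    (hl : 8 * r ≤ l) (hn : 0 < n) (hn' : h + 8 * r ≤ n * r) {ω : Config E}
    (hω : ∀ k ≤ n, ω ∈ Cross L r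
      (chainPt (rot θ (-(4 * r), l / 2) + t) (rot θ (h + 4 * r, l / 2) + t) n k)) :
    CrossingIn L ω ((fun z => rot θ z + t) '' stdRect h l)
      ((fun z => rot θ z + t) '' leftSide h l) ((fun z => rot θ z + t) '' rightSide h l) := by
  have hsc := Real.sin_sq_add_cos_sq θ
  have hs : Real.sin θ ^ 2 ≤ 1 := by nlinarith [sq_nonneg (Real.cos θ)]
  have hc : Real.cos θ ^ 2 ≤ 1 := by nlinarith [sq_nonneg (Real.sin θ)]
  obtain ⟨x, hx, y, hy, hj⟩ := joins_of_strip (L := L) (r := r) (c := Real.cos θ) (s := Real.sin θ)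
    (e := -(Real.cos θ * t.1 + Real.sin θ * t.2)) (c' := -Real.sin θ) (s' := Real.cos θ)
    (e' := Real.sin θ * t.1 - Real.cos θ * t.2) (h := h) (m := l / 2) hr hh
    (by linarith) (by linarith) hn
    (by simp only [rot, Prod.fst_add, Prod.snd_add]; linear_combination (-(4 * r)) * hsc)
    (by simp only [rot, Prod.fst_add, Prod.snd_add]; linear_combination (h + 4 * r) * hsc)
    (by simp only [rot, Prod.fst_add, Prod.snd_add]; linear_combination (l / 2) * hsc)
    (by simp only [rot, Prod.fst_add, Prod.snd_add]; linear_combination (l / 2) * hsc)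
    (by
      have := abs_mul_le_of_sq hc (by linarith) hn'
      simp only [rot, Prod.fst_add]; convert this using 2; ring)
    (by
      have := abs_mul_le_of_sq hs (by linarith) hn'
      simp only [rot, Prod.snd_add]; convert this using 2; ring) hω
  rw [crossingIn_iff]
  have hx' := abs_le.1 hj.source_mem.1.2
  have hy' := abs_le.1 hj.target_mem.1.2
  refine ⟨x, ⟨rotTransInv θ t x, ⟨hx, ?_, ?_⟩, rot_rotTransInv_add θ t x⟩,
    y, ⟨rotTransInv θ t y, ⟨hy, ?_, ?_⟩, rot_rotTransInv_add θ t y⟩,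
    hj.mono (inter_subset_inter_left _ fun z hz => ⟨rotTransInv θ t z, ⟨hz.1.1, hz.1.2, ?_, ?_⟩,
      rot_rotTransInv_add θ t z⟩)⟩ <;> dsimp only [rotTransInv]
  · linarith [hx'.1]
  · linarith [hx'.2]
  · linarith [hy'.1]
  · linarith [hy'.2]
  · linarith [(abs_le.1 hz.2).1]
  · linarith [(abs_le.1 hz.2).2]

lemma bottomTop_of_chain (θ : ℝ) (t : Pt) {h l r : ℝ} {n : ℕ} (hr : 0 ≤ r) (hl : 0 ≤ l)
    (hh : 8 * r ≤ h) (hn : 0 < n) (hn' : l + 8 * r ≤ n * r) {ω : Config E}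
    (hω : ∀ k ≤ n, ω ∈ Cross L r
      (chainPt (rot θ (h / 2, -(4 * r)) + t) (rot θ (h / 2, l + 4 * r) + t) n k)) :
    CrossingIn L ω ((fun z => rot θ z + t) '' stdRect h l)
      ((fun z => rot θ z + t) '' bottomSide h l) ((fun z => rot θ z + t) '' topSide h l) := by
  have hsc := Real.sin_sq_add_cos_sq θ
  have hs : (-Real.sin θ) ^ 2 ≤ 1 := by nlinarith [sq_nonneg (Real.cos θ)]
  have hc : Real.cos θ ^ 2 ≤ 1 := by nlinarith [sq_nonneg (Real.sin θ)]
  obtain ⟨x, hx, y, hy, hj⟩ := joins_of_strip (L := L) (r := r) (c := -Real.sin θ)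
    (s := Real.cos θ) (e := Real.sin θ * t.1 - Real.cos θ * t.2) (c' := Real.cos θ)
    (s' := Real.sin θ) (e' := -(Real.cos θ * t.1 + Real.sin θ * t.2)) (h := l) (m := h / 2) hr hl
    (by linarith) (by linarith) hn
    (by simp only [rot, Prod.fst_add, Prod.snd_add]; linear_combination (-(4 * r)) * hsc)
    (by simp only [rot, Prod.fst_add, Prod.snd_add]; linear_combination (l + 4 * r) * hsc)
    (by simp only [rot, Prod.fst_add, Prod.snd_add]; linear_combination (h / 2) * hsc)
    (by simp only [rot, Prod.fst_add, Prod.snd_add]; linear_combination (h / 2) * hsc)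
    (by
      have := abs_mul_le_of_sq hs (by linarith) hn'
      simp only [rot, Prod.fst_add]; convert this using 2; ring)
    (by
      have := abs_mul_le_of_sq hc (by linarith) hn'
      simp only [rot, Prod.snd_add]; convert this using 2; ring) hω
  rw [crossingIn_iff]
  have hx' := abs_le.1 hj.source_mem.1.2
  have hy' := abs_le.1 hj.target_mem.1.2
  refine ⟨x, ⟨rotTransInv θ t x, ⟨hx, ?_, ?_⟩, rot_rotTransInv_add θ t x⟩,
    y, ⟨rotTransInv θ t y, ⟨hy, ?_, ?_⟩, rot_rotTransInv_add θ t y⟩,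
    hj.mono (inter_subset_inter_left _ fun z hz => ⟨rotTransInv θ t z, ⟨?_, ?_, hz.1.1, hz.1.2⟩,
      rot_rotTransInv_add θ t z⟩)⟩ <;> dsimp only [rotTransInv]
  · linarith [hx'.1]
  · linarith [hx'.2]
  · linarith [hy'.1]
  · linarith [hy'.2]
  · linarith [(abs_le.1 hz.2).1]
  · linarith [(abs_le.1 hz.2).2]

lemma boxCrossingProperty_of_cross {P : Measure (Config E)} [IsProbabilityMeasure P]
    (hL : IsLocallyFinite L) (hP : PositivelyAssociated P)
    (hC : ∃ δ : ENNReal, 0 < δ ∧ ∃ r₀ : ℝ, ∀ r, r₀ ≤ r → ∀ p : Pt, δ ≤ P (Cross L r p)) :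
    BoxCrossingProperty L P := by
  obtain ⟨δ, hδ, r₀, hC⟩ := hC
  intro α hα
  set ε := min α 1 / 8 with hε
  have hε0 : 0 < ε := by positivity
  have hεα : 8 * ε ≤ α := by rw [hε]; linarith [min_le_left α 1]
  have hε1 : 8 * ε ≤ 1 := by rw [hε]; linarith [min_le_right α 1]
  obtain ⟨n, hn⟩ := exists_nat_ge ((max α 1 + 8 * ε) / ε)
  rw [div_le_iff₀ hε0] at hn
  have hnα : α + 8 * ε ≤ n * ε := by linarith [le_max_left α 1]
  have hn1 : 1 + 8 * ε ≤ n * ε := by linarith [le_max_right α 1]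
  have hn0 : 0 < n := by
    rcases Nat.eq_zero_or_pos n with rfl | h
    · norm_num at hn1; linarith
    · exact h
  have hδ1 : δ ≤ 1 := (hC r₀ le_rfl 0).trans prob_le_one
  set η := δ ^ (n + 1) * δ ^ (n + 1) with hη
  have hη0 : 0 < η := by positivity
  have hη1 : η ≠ ⊤ := by
    have : δ ≠ ⊤ := ne_top_of_le_ne_top ENNReal.one_ne_top hδ1
    finiteness
  obtain ⟨N₀, hN₀⟩ := exists_nat_ge (r₀ / ε)
  rw [div_le_iff₀ hε0] at hN₀
  refine ⟨η.toReal, ENNReal.toReal_pos hη0.ne' hη1, N₀, ?_⟩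
  rintro N hN _ ⟨θ, t, rfl⟩
  rw [ENNReal.ofReal_toReal hη1]
  have hN' : (N₀ : ℝ) ≤ N := by exact_mod_cast hN
  have hN0 : (0 : ℝ) ≤ N := Nat.cast_nonneg N
  have hr : r₀ ≤ ε * N := by nlinarith
  have hr0 : 0 ≤ ε * N := by positivity
  have b := isBounded_rotTrans_stdRect θ t (α * N) N
  have c₁ := measure_chain_ge hL hP (hC _ hr) (rot θ (-(4 * (ε * N)), (N : ℝ) / 2) + t)
    (rot θ (α * N + 4 * (ε * N), (N : ℝ) / 2) + t) n
  have c₂ := measure_chain_ge hL hP (hC _ hr) (rot θ (α * N / 2, -(4 * (ε * N))) + t)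
    (rot θ (α * N / 2, N + 4 * (ε * N)) + t) n
  have d₁ := c₁.trans (measure_mono fun ω hω => crossingIn_iff.1
    (leftRight_of_chain (L := L) θ t hr0 (by positivity) (by nlinarith) hn0 (by nlinarith) hω))
  have d₂ := c₂.trans (measure_mono fun ω hω => crossingIn_iff.1
    (bottomTop_of_chain (L := L) θ t hr0 hN0 (by nlinarith) hn0 (by nlinarith) hω))
  refine (mul_le_mul' d₁ d₂).trans ((hP _ _ (measurableSet_joins hL b _ _)
    (measurableSet_joins hL b _ _) (increasingEvent_joins _ _ _)
    (increasingEvent_joins _ _ _)).trans (measure_mono fun ω hω => ?_))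
  exact ⟨crossingIn_iff.2 hω.1, crossingIn_iff.2 hω.2⟩

/-! ### The equivalence -/

lemma CrossingIn.mono {ω : Config E} {S A B S' A' B' : Set Pt} (h : CrossingIn L ω S A B)
    (hS : S ⊆ S') (hA : A ⊆ A') (hB : B ⊆ B') : CrossingIn L ω S' A' B' := by
  rw [crossingIn_iff] at h ⊢
  exact Joins.mono hS hA hB h

lemma ch_and_cv_of_hasBoxCrossings {m n : ℝ} {ω : Config E}
    (h : HasBoxCrossings L ω (2 * m) n (fun z => rot 0 z + (-m, 0))) :
    Ch L m n ω ∧ Cv L m n ω := by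
  obtain ⟨h₁, h₂⟩ := h
  constructor
  · refine h₁.mono ?_ ?_ ?_ <;> rintro _ ⟨z, hz, rfl⟩ <;>
      simp only [stdRect, leftSide, rightSide, mem_ofPred_eq] at hz <;>
      simp [rot] <;> (try constructor) <;> (try constructor) <;> (try constructor) <;> linarith
  · refine h₂.mono ?_ ?_ ?_ <;> rintro _ ⟨z, hz, rfl⟩ <;>
      simp only [stdRect, bottomSide, topSide, mem_ofPred_eq] at hz <;>
      simp [rot] <;> (try constructor) <;> (try constructor) <;> (try constructor) <;> linarith

lemma BoxCrossingProperty.ch_cv {P : Measure (Config E)} (h : BoxCrossingProperty L P) {α : ℝ}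
    (hα : 0 < α) : ∃ δ : ℝ, 0 < δ ∧ ∃ N₀ : ℕ, ∀ N : ℕ, N₀ ≤ N →
      ENNReal.ofReal δ < P {ω | Ch L (α * N) N ω ∧ Cv L (α * N) N ω} := by
  obtain ⟨δ, hδ, N₀, h⟩ := h (2 * α) (by positivity)
  refine ⟨δ / 2, by positivity, N₀, fun N hN => ?_⟩
  have h := h N hN _ ⟨0, (-(α * N), 0), rfl⟩
  refine ((ENNReal.ofReal_lt_ofReal_iff hδ).2 (by linarith)).trans_le
    (h.trans (measure_mono fun ω hω => ch_and_cv_of_hasBoxCrossings ?_))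
  rw [← mul_assoc]
  exact hω

theorem boxCrossingEquiv_of_isDense {P : Measure (Config E)} [IsProbabilityMeasure P]
    (hL : IsLocallyFinite L) (hP : PositivelyAssociated P) {d : ℝ}
    (hd : IsDense (translations L P) d) : BoxCrossingEquiv L P := by
  constructor
  · intro h
    refine ⟨fun α hα => ?_, 1, ?_⟩
    · obtain ⟨δ, hδ, N₀, h⟩ := h.ch_cv hα
      exact ⟨δ, hδ, N₀, fun N hN => (h N hN).trans_le (measure_mono fun ω hω => hω.1)⟩
    · obtain ⟨δ, hδ, N₀, h⟩ := h.ch_cv one_pos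
      exact ⟨δ, one_pos, hδ, N₀, fun N hN => (h N hN).trans_le
        (measure_mono fun ω hω => by simpa using hω.2)⟩
  · rintro ⟨ha, hb⟩
    have hH : ∀ K, 0 < K → HBound L P K := fun K hK => hBound_of_ch hd ha hK
    exact boxCrossingProperty_of_cross hL hP (exists_cross_bound hL hP (hH 3 (by norm_num))
      (vBound_of_exists hL hP hH (exists_vBound_of_cv hd hb) (by norm_num)))

theorem boxCrossingEquiv_of_shifts {P : Measure (Config E)} [IsProbabilityMeasure P]
    (hL : IsLocallyFinite L) (hP : PositivelyAssociated P) {a b : ℝ} (ha : 0 < a) (hb : 0 < b)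
    {σ τ : E → E} (hσ : Function.Surjective σ) (hτ : Function.Surjective τ)
    (hσa : ∀ e, L.ends (σ e) = ((L.ends e).1 + (a, 0), (L.ends e).2 + (a, 0)))
    (hτb : ∀ e, L.ends (τ e) = ((L.ends e).1 + (0, b), (L.ends e).2 + (0, b)))
    (hσP : TranslationInvariantUnder P σ) (hτP : TranslationInvariantUnder P τ) :
    BoxCrossingEquiv L P :=
  boxCrossingEquiv_of_isDense hL hP (isDense_of_mem ha hb (mem_translations hL hσ hσa hσP)
    (mem_translations hL hτ hτb hτP))

lemma isLocallyFinite_of_base {κ : Type} [Finite κ] {L : LatticeOn (ℤ × ℤ × κ)} {a b s R : ℝ}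
    (ha : 0 < a) (hb : 0 < b)
    (h : ∀ i j k, ∀ z ∈ ({(L.ends (i, j, k)).1, (L.ends (i, j, k)).2} : Set Pt),
      |z.1 - (a * i + s * j)| ≤ R ∧ |z.2 - b * j| ≤ R) : IsLocallyFinite L := by
  intro S hS
  obtain ⟨M, hM⟩ := hS.subset_closedBall 0
  obtain ⟨J, hJ⟩ := exists_nat_ge ((M + R) / b)
  obtain ⟨I, hI⟩ := exists_nat_ge ((M + R + |s| * J) / a)
  rw [div_le_iff₀ hb] at hJ
  rw [div_le_iff₀ ha] at hI
  refine ((finite_Icc (-(I : ℤ)) I).prod ((finite_Icc (-(J : ℤ)) J).prod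
    (finite_univ : (univ : Set κ).Finite))).subset ?_
  rintro ⟨i, j, k⟩ ⟨z, hz, hzS⟩
  have hconv : Convex ℝ {z : Pt | |z.1 - (a * i + s * j)| ≤ R ∧ |z.2 - b * j| ≤ R} := by
    have : {z : Pt | |z.1 - (a * i + s * j)| ≤ R ∧ |z.2 - b * j| ≤ R} =
        Icc (a * i + s * j - R) (a * i + s * j + R) ×ˢ Icc (b * j - R) (b * j + R) := by
      ext z
      simp only [mem_ofPred_eq, mem_prod, mem_Icc, abs_le]
      constructor
      · rintro ⟨⟨h₁, h₂⟩, h₃, h₄⟩; refine ⟨⟨?_, ?_⟩, ?_, ?_⟩ <;> linarith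
      · rintro ⟨⟨h₁, h₂⟩, h₃, h₄⟩; refine ⟨⟨?_, ?_⟩, ?_, ?_⟩ <;> linarith
    rw [this]
    exact (convex_Icc _ _).prod (convex_Icc _ _)
  obtain ⟨h₁, h₂⟩ := hconv.segment_subset (h i j k _ (by simp)) (h i j k _ (by simp)) hz
  have hzM : max |z.1| |z.2| ≤ M := by simpa [Prod.norm_def] using hM hzS
  have z₁ := abs_le.1 ((le_max_left _ _).trans hzM)
  have z₂ := abs_le.1 ((le_max_right _ _).trans hzM)
  rw [abs_le] at h₁ h₂
  have hj : |(j : ℝ)| ≤ J := by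
    rw [abs_le]
    constructor <;> nlinarith
  have hsj := abs_le.1 ((abs_mul s j).trans_le (mul_le_mul_of_nonneg_left hj (abs_nonneg s)))
  have hi : |(i : ℝ)| ≤ I := by
    rw [abs_le]
    constructor <;> nlinarith
  rw [abs_le] at hi hj
  refine ⟨⟨?_, ?_⟩, ⟨?_, ?_⟩, mem_univ _⟩
  · exact_mod_cast hi.1
  · exact_mod_cast hi.2
  · exact_mod_cast hj.1
  · exact_mod_cast hj.2

end Events

/-! ### The three lattices -/

lemma surjective_shift {κ : Type} (k l : ℤ) :
    Function.Surjective fun e : ℤ × ℤ × κ => (e.1 + k, e.2.1 + l, e.2.2) :=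
  fun e => ⟨(e.1 - k, e.2.1 - l, e.2.2), by simp⟩

lemma sqrt_three_le_two : Real.sqrt 3 ≤ 2 := by
  rw [Real.sqrt_le_left (by norm_num)]; norm_num

lemma isLocallyFinite_sqLattice : IsLocallyFinite sqLattice := by
  refine isLocallyFinite_of_base (a := 1) (b := 1) (s := 0) (R := 1) one_pos one_pos ?_
  rintro i j (_ | _) z (rfl | rfl) <;> simp [sqLattice]

lemma isLocallyFinite_triLattice : IsLocallyFinite triLattice := by
  have h3 := Real.sqrt_nonneg 3
  have h2 := sqrt_three_le_two
  refine isLocallyFinite_of_base (a := Real.sqrt 3) (b := 3 / 2) (s := Real.sqrt 3 / 2)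
    (R := 4) (by positivity) (by norm_num) ?_
  intro i j k z hz
  rw [abs_le, abs_le]
  fin_cases k <;> rcases hz with rfl | rfl <;> simp [triLattice, tv] <;>
    (try constructor) <;> (try constructor) <;> ring_nf <;> linarith

lemma isLocallyFinite_hexLattice : IsLocallyFinite hexLattice := by
  have h3 := Real.sqrt_nonneg 3
  have h2 := sqrt_three_le_two
  refine isLocallyFinite_of_base (a := Real.sqrt 3) (b := 3 / 2) (s := Real.sqrt 3 / 2)
    (R := 4) (by positivity) (by norm_num) ?_
  intro i j k z hz
  rw [abs_le, abs_le]
  fin_cases k <;> rcases hz with rfl | rfl <;> simp [hexLattice, hup, hdown] <;>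
    refine ⟨⟨?_, ?_⟩, ?_, ?_⟩ <;> ring_nf <;> linarith

/-- On each of the square, triangular and hexagonal lattices, a
translation-invariant (under the two minimal lattice translations, by `(1,0)`,`(0,1)`
for the square lattice and by `(√3,0)`,`(0,3)` for the triangular/hexagonal lattices)
positively associated probability measure has the box-crossing property if and only if
conditions (a) and (b) hold. -/
theorem box_crossing_criterion :
    (∀ P : Measure (Config SqE), IsProbabilityMeasure P →
      TranslationInvariantUnder P (fun e => (e.1 + 1, e.2.1, e.2.2)) →
      TranslationInvariantUnder P (fun e => (e.1, e.2.1 + 1, e.2.2)) →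
      PositivelyAssociated P → BoxCrossingEquiv sqLattice P) ∧
    (∀ P : Measure (Config TriE), IsProbabilityMeasure P →
      TranslationInvariantUnder P (fun e => (e.1 + 1, e.2.1, e.2.2)) →
      TranslationInvariantUnder P (fun e => (e.1 - 1, e.2.1 + 2, e.2.2)) →
      PositivelyAssociated P → BoxCrossingEquiv triLattice P) ∧
    (∀ P : Measure (Config TriE), IsProbabilityMeasure P →
      TranslationInvariantUnder P (fun e => (e.1 + 1, e.2.1, e.2.2)) →
      TranslationInvariantUnder P (fun e => (e.1 - 1, e.2.1 + 2, e.2.2)) →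
      PositivelyAssociated P → BoxCrossingEquiv hexLattice P) := by
  refine ⟨fun P _ h₁ h₂ hP => ?_, fun P _ h₁ h₂ hP => ?_, fun P _ h₁ h₂ hP => ?_⟩
  · refine boxCrossingEquiv_of_shifts isLocallyFinite_sqLattice hP one_pos one_pos
      (by simpa using surjective_shift 1 0) (by simpa using surjective_shift 0 1) ?_ ?_ h₁ h₂
    · rintro ⟨i, j, _ | _⟩ <;> simp [sqLattice]
    · rintro ⟨i, j, _ | _⟩ <;> simp [sqLattice]
  · refine boxCrossingEquiv_of_shifts isLocallyFinite_triLattice hP (a := Real.sqrt 3) (b := 3)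
      (by positivity) (by norm_num) (by simpa using surjective_shift 1 0)
      (by simpa [sub_eq_add_neg] using surjective_shift (-1) 2) ?_ ?_ h₁ h₂
    · rintro ⟨i, j, k⟩
      fin_cases k <;> simp [triLattice, tv] <;> ring_nf <;> simp
    · rintro ⟨i, j, k⟩
      fin_cases k <;> simp [triLattice, tv] <;> ring_nf <;> simp
  · refine boxCrossingEquiv_of_shifts isLocallyFinite_hexLattice hP (a := Real.sqrt 3) (b := 3)
      (by positivity) (by norm_num) (by simpa using surjective_shift 1 0)
      (by simpa [sub_eq_add_neg] using surjective_shift (-1) 2) ?_ ?_ h₁ h₂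
    · rintro ⟨i, j, k⟩
      fin_cases k <;> simp [hexLattice, hup, hdown] <;> ring_nf <;> simp
    · rintro ⟨i, j, k⟩
      fin_cases k <;> simp [hexLattice, hup, hdown] <;> ring_nf <;> simp

end Perc
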